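/- Let (M,φ,ξ,η,g) be an anti-quasi-Sasakian manifold with ψ = -∇ξ. Then the Ricci tensor satisfies Ric(ξ,ξ) = |∇ξ|² = |ψ|² and Ric(ξ,X) = 0 for every vector field X tangent to D = ker η. Consequently, the Ricci operator Q (defined by g(QX,Y) = Ric(X,Y)) satisfies Qξ = |ψ|²ξ and commutes with φ: Qφ = φQ. -/

import Mathlib

/-!
We work in a Koszul-style algebraic framework for the calculus of vector fields on a
smooth manifold: `F` plays the role of the commutative ℝ-algebra of smooth functions
on the manifold `M`, and `V` plays the role of the `F`-module of smooth vector fields.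
`act` is the action of vector fields on functions (as ℝ-derivations) and `lie` is the
Lie bracket of vector fields.  All the classical tensors (differentials of forms via the
global Koszul formulas, the Nijenhuis torsion, Lie derivatives, Levi-Civita connection,
curvature, ...) are expressed through their standard global formulas in this framework.
-/

structure VFCalc (F : Type) (V : Type) [CommRing F] [Algebra ℝ F]
    [AddCommGroup V] [Module F V] where
  /-- action of a vector field on a function, `X f` -/
  act : V → F → F
  /-- Lie bracket of vector fields -/
  lie : V → V → V
  act_addV : ∀ X Y f, act (X + Y) f = act X f + act Y f
  act_smulV : ∀ (h : F) (X : V) (f : F), act (h • X) f = h * act X f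
  act_add : ∀ X f g, act X (f + g) = act X f + act X g
  act_mul : ∀ X f g, act X (f * g) = act X f * g + f * act X g
  act_algebraMap : ∀ X (r : ℝ), act X (algebraMap ℝ F r) = 0
  lie_add_left : ∀ X Y Z, lie (X + Y) Z = lie X Z + lie Y Z
  lie_skew : ∀ X Y, lie X Y = -lie Y X
  lie_smul_right : ∀ (f : F) (X Y : V), lie X (f • Y) = act X f • Y + f • lie X Y
  lie_jacobi : ∀ X Y Z, lie X (lie Y Z) + lie Y (lie Z X) + lie Z (lie X Y) = 0
  act_lie : ∀ X Y f, act (lie X Y) f = act X (act Y f) - act Y (act X f)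

namespace VFCalc

variable {F V : Type} [CommRing F] [Algebra ℝ F] [AddCommGroup V] [Module F V]
variable (C : VFCalc F V)

/-- Exterior differential of a 1-form, `dη(X,Y) = X(η(Y)) - Y(η(X)) - η([X,Y])`. -/
def d1 (η : V → F) (X Y : V) : F := C.act X (η Y) - C.act Y (η X) - η (C.lie X Y)

/-- Exterior differential of a 2-form (Koszul global formula). -/
def d2 (ω : V → V → F) (X Y Z : V) : F :=
  C.act X (ω Y Z) - C.act Y (ω X Z) + C.act Z (ω X Y)
    - ω (C.lie X Y) Z + ω (C.lie X Z) Y - ω (C.lie Y Z) X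

/-- The tensor `N_φ = [φ,φ] + dη ⊗ ξ` of an almost contact structure. -/
def nij (φ : V → V) (ξ : V) (η : V → F) (X Y : V) : V :=
  C.lie (φ X) (φ Y) + φ (φ (C.lie X Y)) - φ (C.lie X (φ Y)) - φ (C.lie (φ X) Y)
    + C.d1 η X Y • ξ

/-- `ξ` is a Killing vector field for `g`, i.e. `L_ξ g = 0`. -/
def IsKilling (g : V → V → F) (ξ : V) : Prop :=
  ∀ X Y, C.act ξ (g X Y) - g (C.lie ξ X) Y - g X (C.lie ξ Y) = 0

/-- Riemann curvature tensor `R(X,Y)Z = ∇_X ∇_Y Z - ∇_Y ∇_X Z - ∇_{[X,Y]} Z`. -/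
def curv (D : V → V → V) (X Y Z : V) : V :=
  D X (D Y Z) - D Y (D X Z) - D (C.lie X Y) Z

end VFCalc

/-- An almost contact structure `(φ, ξ, η)` (without metric): `φ² = -I + η ⊗ ξ`, `η(ξ)=1`. -/
structure IsACS {F V : Type} [CommRing F] [AddCommGroup V] [Module F V]
    (φ : V → V) (ξ : V) (η : V → F) : Prop where
  φ_add : ∀ X Y, φ (X + Y) = φ X + φ Y
  φ_smul : ∀ (f : F) (X : V), φ (f • X) = f • φ X
  η_add : ∀ X Y, η (X + Y) = η X + η Y
  η_smul : ∀ (f : F) (X : V), η (f • X) = f * η X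
  φ_sq : ∀ X, φ (φ X) = -X + η X • ξ
  η_ξ : η ξ = 1

/-- An almost contact metric structure `(φ, ξ, η, g)`. -/
structure IsACMS {F V : Type} [CommRing F] [AddCommGroup V] [Module F V]
    (φ : V → V) (ξ : V) (η : V → F) (g : V → V → F) : Prop where
  φ_add : ∀ X Y, φ (X + Y) = φ X + φ Y
  φ_smul : ∀ (f : F) (X : V), φ (f • X) = f • φ X
  η_add : ∀ X Y, η (X + Y) = η X + η Y
  η_smul : ∀ (f : F) (X : V), η (f • X) = f * η X
  g_add_left : ∀ X Y Z, g (X + Y) Z = g X Z + g Y Z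
  g_smul_left : ∀ (f : F) (X Y : V), g (f • X) Y = f * g X Y
  g_symm : ∀ X Y, g X Y = g Y X
  φ_sq : ∀ X, φ (φ X) = -X + η X • ξ
  η_ξ : η ξ = 1
  g_compat : ∀ X Y, g (φ X) (φ Y) = g X Y - η X * η Y

/-- The fundamental 2-form `Φ(X,Y) = g(X, φY)`. -/
def fund {F V : Type} [CommRing F] [AddCommGroup V] [Module F V]
    (g : V → V → F) (φ : V → V) (X Y : V) : F := g X (φ Y)

/-- The axioms of the Levi-Civita connection of `g` (which characterize it uniquely). -/
structure IsLeviCivita {F V : Type} [CommRing F] [Algebra ℝ F] [AddCommGroup V] [Module F V]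
    (C : VFCalc F V) (g : V → V → F) (D : V → V → V) : Prop where
  add_left : ∀ X Y Z, D (X + Y) Z = D X Z + D Y Z
  smul_left : ∀ (f : F) (X Y : V), D (f • X) Y = f • D X Y
  add_right : ∀ X Y Z, D X (Y + Z) = D X Y + D X Z
  leibniz : ∀ (f : F) (X Y : V), D X (f • Y) = C.act X f • Y + f • D X Y
  torsion_free : ∀ X Y, D X Y - D Y X = C.lie X Y
  metric : ∀ X Y Z, C.act X (g Y Z) = g (D X Y) Z + g Y (D X Z)

/-- Anti-normality: `N_φ = 2 dη ⊗ ξ`. -/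
def AntiNormal {F V : Type} [CommRing F] [Algebra ℝ F] [AddCommGroup V] [Module F V]
    (C : VFCalc F V) (φ : V → V) (ξ : V) (η : V → F) : Prop :=
  ∀ X Y, C.nij φ ξ η X Y = (2 * C.d1 η X Y) • ξ

/-- Anti-quasi-Sasakian: `dΦ = 0` and `N_φ = 2 dη ⊗ ξ`. -/
def IsAqS {F V : Type} [CommRing F] [Algebra ℝ F] [AddCommGroup V] [Module F V]
    (C : VFCalc F V) (φ : V → V) (ξ : V) (η : V → F) (g : V → V → F) : Prop :=
  (∀ X Y Z, C.d2 (fund g φ) X Y Z = 0) ∧ AntiNormal C φ ξ η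

open scoped BigOperators

/-- The Ricci tensor, computed through a global orthonormal frame `e`:
`Ric(X,Y) = Σᵢ g(R(eᵢ,X)Y, eᵢ)`. -/
def ricci {F V : Type} [CommRing F] [Algebra ℝ F] [AddCommGroup V] [Module F V]
    (C : VFCalc F V) (D : V → V → V) (g : V → V → F) {d : ℕ} (e : Fin d → V)
    (X Y : V) : F :=
  ∑ i, g (C.curv D (e i) X Y) (e i)

set_option linter.unusedSectionVars false
set_option linter.unusedSimpArgs false
section Basics
variable {F V : Type} [CommRing F] [Algebra ℝ F] [AddCommGroup V] [Module F V]

theorem two_cancel' (x : F) (h : 2 * x = 0) : x = 0 := by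
  have h2 : algebraMap ℝ F (1/2) * 2 = 1 := by
    rw [← map_ofNat (algebraMap ℝ F) 2, ← map_mul]; norm_num
  calc x = (algebraMap ℝ F (1/2) * 2) * x := by rw [h2, one_mul]
    _ = 0 := by rw [mul_assoc, h, mul_zero]

namespace VFCalc
variable (C : VFCalc F V)
theorem act_zero (X : V) : C.act X 0 = 0 := by
  have := C.act_add X 0 0; simpa using this
theorem act_one (X : V) : C.act X 1 = 0 := by
  have := C.act_algebraMap X 1; simpa using this
theorem act_neg (X : V) (f : F) : C.act X (-f) = - C.act X f := by
  have := C.act_add X f (-f); rw [add_neg_cancel, act_zero] at this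
  linear_combination -this
theorem act_sub (X : V) (f g : F) : C.act X (f - g) = C.act X f - C.act X g := by
  rw [sub_eq_add_neg, C.act_add, act_neg, sub_eq_add_neg]
theorem lie_add_right (X Y Z : V) : C.lie X (Y + Z) = C.lie X Y + C.lie X Z := by
  rw [C.lie_skew, C.lie_add_left, C.lie_skew Y, C.lie_skew Z]; abel
theorem lie_neg_right (X Y : V) : C.lie X (-Y) = - C.lie X Y := by
  have h0 : C.lie X 0 = 0 := by have := C.lie_add_right X 0 0; simpa using this
  have := C.lie_add_right X Y (-Y); rw [add_neg_cancel, h0] at this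
  exact (neg_eq_of_add_eq_zero_right this.symm).symm
theorem lie_sub_right (X Y Z : V) : C.lie X (Y - Z) = C.lie X Y - C.lie X Z := by
  rw [sub_eq_add_neg, C.lie_add_right, lie_neg_right, sub_eq_add_neg]
theorem lie_zero_right (X : V) : C.lie X 0 = 0 := by
  have := C.lie_add_right X 0 0; simpa using this
theorem lie_neg_left (X Y : V) : C.lie (-X) Y = - C.lie X Y := by
  rw [C.lie_skew, C.lie_neg_right, C.lie_skew Y, neg_neg]
theorem lie_sub_left (X Y Z : V) : C.lie (X - Y) Z = C.lie X Z - C.lie Y Z := by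
  rw [sub_eq_add_neg, C.lie_add_left, lie_neg_left, sub_eq_add_neg]
theorem lie_smul_left (f : F) (X Y : V) :
    C.lie (f • X) Y = - C.act Y f • X + f • C.lie X Y := by
  rw [C.lie_skew, C.lie_smul_right, C.lie_skew Y]; module
end VFCalc

namespace IsACMS
variable {φ : V → V} {ξ : V} {η : V → F} {g : V → V → F} (h : IsACMS φ ξ η g)
include h
theorem g_add_right (X Y Z : V) : g X (Y + Z) = g X Y + g X Z := by
  rw [h.g_symm, h.g_add_left, h.g_symm Y, h.g_symm Z]
theorem g_smul_right (f : F) (X Y : V) : g X (f • Y) = f * g X Y := by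
  rw [h.g_symm, h.g_smul_left, h.g_symm Y]
theorem g_zero_left (Y : V) : g 0 Y = 0 := by simpa using h.g_smul_left 0 0 Y
theorem g_zero_right (Y : V) : g Y 0 = 0 := by simpa using h.g_smul_right 0 Y 0
theorem g_neg_left (X Y : V) : g (-X) Y = - g X Y := by simpa using h.g_smul_left (-1) X Y
theorem g_neg_right (X Y : V) : g X (-Y) = - g X Y := by simpa using h.g_smul_right (-1) X Y
theorem g_sub_left (X Y Z : V) : g (X - Y) Z = g X Z - g Y Z := by
  rw [sub_eq_add_neg, h.g_add_left, h.g_neg_left, sub_eq_add_neg]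
theorem g_sub_right (X Y Z : V) : g X (Y - Z) = g X Y - g X Z := by
  rw [sub_eq_add_neg, h.g_add_right, h.g_neg_right, sub_eq_add_neg]
theorem φ_zero : φ 0 = 0 := by simpa using h.φ_smul 0 0
theorem φ_neg (X : V) : φ (-X) = - φ X := by simpa using h.φ_smul (-1) X
theorem φ_sub (X Y : V) : φ (X - Y) = φ X - φ Y := by
  rw [sub_eq_add_neg, h.φ_add, h.φ_neg, sub_eq_add_neg]
theorem η_zero : η 0 = 0 := by simpa using h.η_smul 0 0
theorem η_neg (X : V) : η (-X) = - η X := by simpa using h.η_smul (-1) X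
theorem η_sub (X Y : V) : η (X - Y) = η X - η Y := by
  rw [sub_eq_add_neg, h.η_add, h.η_neg, sub_eq_add_neg]
theorem φξ' : φ ξ = η (φ ξ) • ξ := by
  have h1 := h.φ_sq (φ ξ)
  have h2 : φ (φ ξ) = 0 := by rw [h.φ_sq, h.η_ξ]; simp
  rw [h2, h.φ_zero] at h1
  exact (neg_add_eq_zero.mp h1.symm)
theorem aa : η (φ ξ) * η (φ ξ) = 0 := by
  have h2 : φ (φ ξ) = 0 := by rw [h.φ_sq, h.η_ξ]; simp
  rw [h.φξ', h.φ_smul, h.φξ', smul_smul] at h2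
  have := congrArg η h2
  simp only [h.η_smul, h.η_ξ, h.η_zero, mul_one] at this ⊢
  exact this
theorem ηφ (X : V) : η (φ X) = η (φ ξ) * η X := by
  have h1 := h.φ_sq (φ X)
  rw [h.φ_sq X, h.φ_add, h.φ_neg, h.φ_smul] at h1
  have := congrArg η h1
  simp only [h.η_add, h.η_neg, h.η_smul, h.η_ξ] at this
  linear_combination -this
theorem gξ (X : V) : g X ξ = η X := by
  have h1 := h.g_compat X ξ
  have h2 := h.g_compat (φ X) ξ
  have hp := h.ηφ X
  have hx := h.φξ'
  have ha := h.aa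
  generalize η (φ ξ) = a at *
  rw [hx, h.g_smul_right, h.η_ξ] at h1 h2
  rw [h.φ_sq, h.g_add_left, h.g_neg_left, h.g_smul_left, hp] at h2
  linear_combination (-1) * h1 - a * h2 + (-g X ξ + η X * g ξ ξ + η X) * ha
theorem gξ' (X : V) : g ξ X = η X := by rw [h.g_symm, h.gξ]
theorem skew' (X Y : V) : g X (φ Y) + g (φ X) Y = 2 * η (φ ξ) * η X * η Y := by
  have h1 := h.g_compat X (φ Y)
  rw [h.φ_sq, h.g_add_right, h.g_neg_right, h.g_smul_right, h.gξ, h.ηφ X, h.ηφ Y] at h1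
  linear_combination -h1
end IsACMS

namespace IsLeviCivita
variable {C : VFCalc F V} {g : V → V → F} {D : V → V → V} (h : IsLeviCivita C g D)
include h
theorem neg_left (X Y : V) : D (-X) Y = - D X Y := by simpa using h.smul_left (-1) X Y
theorem zero_right (X : V) : D X 0 = 0 := by simpa using h.add_right X 0 0
theorem zero_left (X : V) : D 0 X = 0 := by simpa using h.add_left 0 0 X
theorem neg_right (X Y : V) : D X (-Y) = - D X Y := by
  have := h.add_right X Y (-Y)
  rw [add_neg_cancel, h.zero_right] at this
  exact (neg_eq_of_add_eq_zero_right this.symm).symm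
theorem sub_left (X Y Z : V) : D (X - Y) Z = D X Z - D Y Z := by
  rw [sub_eq_add_neg, h.add_left, h.neg_left, sub_eq_add_neg]
theorem sub_right (X Y Z : V) : D X (Y - Z) = D X Y - D X Z := by
  rw [sub_eq_add_neg, h.add_right, h.neg_right, sub_eq_add_neg]
end IsLeviCivita
end Basics

section Reduction
variable {F V : Type} [CommRing F] [Algebra ℝ F] [AddCommGroup V] [Module F V]
variable {C : VFCalc F V} {φ : V → V} {ξ : V} {η : V → F} {g : V → V → F}

theorem red_af (h : IsACMS φ ξ η g) (hA : IsAqS C φ ξ η g) (Z : V) (f : F) :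
    C.act Z (η (φ ξ) * f) = 0 := by
  have h1 := hA.1 (f • ξ) ξ Z
  have h2 := hA.1 ξ (f • ξ) Z
  have h3 : fund g φ (C.lie ξ (f • ξ)) Z = - fund g φ (C.lie (f • ξ) ξ) Z := by
    unfold fund; rw [C.lie_skew ξ, h.g_neg_left]
  simp only [VFCalc.d2] at h1 h2
  have e1 : fund g φ (f • ξ) ξ = η (φ ξ) * f := by
    rw [fund, h.g_smul_left, h.gξ']; ring
  have e2 : fund g φ ξ (f • ξ) = η (φ ξ) * f := by
    rw [fund, h.φ_smul, h.g_smul_right, h.gξ']; ring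
  rw [e1] at h1
  rw [e2] at h2
  apply two_cancel'
  linear_combination h1 + h2 + h3

theorem red_f (h : IsACMS φ ξ η g) (hA : IsAqS C φ ξ η g) (Z : V) (f : F) :
    η (φ ξ) * C.act Z f = 0 := by
  have h1 := red_af h hA Z f
  have h2 := red_af h hA Z 1
  rw [mul_one] at h2
  rw [C.act_mul, h2] at h1
  linear_combination h1

theorem red_lie (h : IsACMS φ ξ η g) (hA : IsAqS C φ ξ η g) (Z W : V) (f : F) :
    C.lie Z ((η (φ ξ) * f) • W) = (η (φ ξ) * f) • C.lie Z W := by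
  rw [C.lie_smul_right, red_af h hA, zero_smul, zero_add]

theorem red_lie_left (h : IsACMS φ ξ η g) (hA : IsAqS C φ ξ η g) (Z W : V) (f : F) :
    C.lie ((η (φ ξ) * f) • W) Z = (η (φ ξ) * f) • C.lie W Z := by
  rw [C.lie_smul_left, red_af h hA, neg_zero, zero_smul, zero_add]

theorem red_E (hA : IsAqS C φ ξ η g) (X Y : V) :
    C.lie (φ X) (φ Y) + φ (φ (C.lie X Y)) - φ (C.lie X (φ Y)) - φ (C.lie (φ X) Y)
      = C.d1 η X Y • ξ := by
  have := hA.2 X Y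
  rw [VFCalc.nij, mul_smul, two_smul] at this
  exact add_right_cancel this

theorem red_ηφφ (h : IsACMS φ ξ η g) (X : V) : η (φ (φ X)) = 0 := by
  rw [h.φ_sq, h.η_add, h.η_neg, h.η_smul, h.η_ξ]; ring

theorem red_Eξ (h : IsACMS φ ξ η g) (hA : IsAqS C φ ξ η g) (X : V) :
    η (φ ξ) • C.lie (φ X) ξ + φ (φ (C.lie X ξ)) - η (φ ξ) • φ (C.lie X ξ) - φ (C.lie (φ X) ξ)
      = C.d1 η X ξ • ξ := by
  have h1 := red_E hA X ξ
  have e : φ ξ = (η (φ ξ) * 1) • ξ := by rw [mul_one]; exact h.φξ'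
  have e1 : C.lie (φ X) (φ ξ) = η (φ ξ) • C.lie (φ X) ξ := by
    rw [e, red_lie h hA, ← e, mul_one]
  have e2 : C.lie X (φ ξ) = η (φ ξ) • C.lie X ξ := by
    rw [e, red_lie h hA, ← e, mul_one]
  rw [e1, e2, h.φ_smul] at h1
  exact h1

theorem red_dη (h : IsACMS φ ξ η g) (hA : IsAqS C φ ξ η g) (X : V) : C.d1 η X ξ = 0 := by
  have h1 := congrArg η (red_Eξ h hA X)
  simp only [h.η_sub, h.η_add, h.η_smul, h.η_ξ, red_ηφφ h] at h1
  rw [h.ηφ (C.lie X ξ), h.ηφ (C.lie (φ X) ξ)] at h1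
  linear_combination -h1 - η (C.lie X ξ) * h.aa

theorem red_ηlie (h : IsACMS φ ξ η g) (hA : IsAqS C φ ξ η g) (X : V) :
    η (C.lie X ξ) = - C.act ξ (η X) := by
  have := red_dη h hA X
  rw [VFCalc.d1, h.η_ξ, C.act_one] at this
  linear_combination -this

theorem red_a1 (h : IsACMS φ ξ η g) (hA : IsAqS C φ ξ η g) (X : V) :
    η (φ ξ) • C.lie (φ X) ξ = η (φ ξ) • φ (C.lie X ξ) := by
  have h1 := red_Eξ h hA X
  rw [red_dη h hA, zero_smul] at h1
  have h2 := congrArg (fun v => η (φ ξ) • φ v) h1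
  simp only [h.φ_sub, h.φ_add, h.φ_smul, h.φ_zero, smul_zero, smul_sub, smul_add, smul_smul, h.aa,
    zero_smul] at h2
  have e1 := h.φ_sq (φ (C.lie X ξ))
  have e2 := h.φ_sq (C.lie (φ X) ξ)
  have e4 : η (φ (C.lie X ξ)) = 0 := by
    rw [h.ηφ, red_ηlie h hA, mul_neg, red_f h hA, neg_zero]
  have e5 : η (C.lie (φ X) ξ) = 0 := by
    rw [red_ηlie h hA, h.ηφ, red_af h hA, neg_zero]
  rw [e1, e2, e4, e5] at h2
  simp only [zero_smul, add_zero, smul_neg, zero_add, sub_zero] at h2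
  rw [sub_neg_eq_add, neg_add_eq_zero] at h2
  exact h2.symm

theorem red_lieφ (h : IsACMS φ ξ η g) (hA : IsAqS C φ ξ η g) (X : V) :
    C.lie (φ X) ξ = φ (C.lie X ξ) := by
  have h1 := red_Eξ h hA X
  rw [red_dη h hA, zero_smul, red_a1 h hA] at h1
  have h2 := congrArg φ h1
  simp only [h.φ_sub, h.φ_add, h.φ_smul, h.φ_zero] at h2
  have e1 := h.φ_sq (φ (C.lie X ξ))
  have e2 := h.φ_sq (C.lie (φ X) ξ)
  have e4 : η (φ (C.lie X ξ)) = 0 := by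
    rw [h.ηφ, red_ηlie h hA, mul_neg, red_f h hA, neg_zero]
  have e5 : η (C.lie (φ X) ξ) = 0 := by
    rw [red_ηlie h hA, h.ηφ, red_af h hA, neg_zero]
  rw [e1, e2, e4, e5] at h2
  simp only [zero_smul, add_zero] at h2
  rw [add_sub_cancel_left, sub_neg_eq_add, neg_add_eq_zero] at h2
  exact h2.symm

theorem red_ω0 (h : IsACMS φ ξ η g) (hA : IsAqS C φ ξ η g) (X : V) :
    η (φ ξ) * η (C.lie X ξ) = 0 := by
  rw [red_ηlie h hA, mul_neg, red_f h hA, neg_zero]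

theorem red_ω1 (h : IsACMS φ ξ η g) (hA : IsAqS C φ ξ η g) (X Y : V) :
    η (φ ξ) * η (C.lie (φ X) (φ Y)) = - (η (φ ξ) * η (C.lie X Y)) := by
  have h1 := congrArg η (red_E hA X Y)
  simp only [h.η_sub, h.η_add, h.η_smul, h.η_ξ, red_ηφφ h, VFCalc.d1] at h1
  rw [h.ηφ (C.lie X (φ Y)), h.ηφ (C.lie (φ X) Y)] at h1
  linear_combination η (φ ξ) * h1 + (η (C.lie X (φ Y)) + η (C.lie (φ X) Y)) * h.aa +
    red_f h hA X (η Y) - red_f h hA Y (η X)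

theorem red_ωφφ (h : IsACMS φ ξ η g) (hA : IsAqS C φ ξ η g) (X Y : V) :
    η (φ ξ) * η (C.lie X (φ (φ Y))) = - (η (φ ξ) * η (C.lie X Y)) := by
  rw [h.φ_sq, C.lie_add_right, C.lie_neg_right, C.lie_smul_right, h.η_add, h.η_add, h.η_neg,
    h.η_smul, h.η_smul, h.η_ξ]
  linear_combination red_f h hA X (η Y) + η Y * red_ω0 h hA X

theorem red_ωsymm (h : IsACMS φ ξ η g) (X Y : V) :
    η (φ ξ) * η (C.lie X Y) = - (η (φ ξ) * η (C.lie Y X)) := by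
  rw [C.lie_skew, h.η_neg]; ring

theorem red_h (h : IsACMS φ ξ η g) (hA : IsAqS C φ ξ η g) (X Y : V) :
    C.act ξ (g X (φ Y)) + g (C.lie X ξ) (φ Y) + g X (C.lie (φ Y) ξ)
      = η (φ ξ) * η (C.lie X Y) := by
  have h1 := hA.1 X Y ξ
  have e : ∀ W, fund g φ W ξ = η (φ ξ) * η W := fun W => by
    have : φ ξ = η (φ ξ) • ξ := h.φξ'
    rw [fund]; nth_rw 1 [this]; rw [h.g_smul_right, h.gξ]
  simp only [VFCalc.d2, e, red_af h hA] at h1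
  simp only [fund] at h1
  have h2 := h.skew' (C.lie Y ξ) X
  have h3 := red_ω0 h hA Y
  rw [red_lieφ h hA, h.g_symm X (φ (C.lie Y ξ))]
  linear_combination h1 + h2 + 2 * η X * h3

theorem red_ω (h : IsACMS φ ξ η g) (hA : IsAqS C φ ξ η g) (X Y : V) :
    η (φ ξ) * η (C.lie X Y) = 0 := by
  have key : ∀ X Y, η (φ ξ) * η (C.lie (φ X) Y) = 0 := fun X Y => by
    have h1 := red_h h hA (φ X) Y
    have h2 := red_h h hA (φ Y) X
    rw [h.g_symm (φ Y) (φ X), h.g_symm (φ Y), h.g_symm _ (φ X)] at h2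
    have h3 := red_ωsymm (C := C) h (φ Y) X
    have h4 := red_ω1 h hA X (φ Y)
    have h5 := red_ωφφ h hA (φ X) Y
    apply two_cancel'
    linear_combination h2 - h1 + h3 - h4 + h5
  have h1 := key Y X
  have h2 := key (φ Y) X
  have h3 := red_ωφφ h hA X Y
  have h4 := red_ωsymm (C := C) h X (φ (φ Y))
  linear_combination h2 + h3 - h4

theorem red_ACMS (h : IsACMS φ ξ η g) :
    IsACMS (fun X => φ X - (η (φ ξ) * η X) • ξ) ξ η g where
  φ_add X Y := by rw [h.φ_add, h.η_add]; module
  φ_smul f X := by rw [h.φ_smul, h.η_smul]; module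
  η_add := h.η_add
  η_smul := h.η_smul
  g_add_left := h.g_add_left
  g_smul_left := h.g_smul_left
  g_symm := h.g_symm
  η_ξ := h.η_ξ
  φ_sq X := by
    have e : φ ξ = η (φ ξ) • ξ := h.φξ'
    have ha := h.aa
    have e2 := h.ηφ X
    simp only [h.φ_sub, h.φ_smul, h.η_sub, h.η_smul, h.η_ξ, h.φ_sq]
    generalize η (φ ξ) = a at *
    rw [e2, e]
    have e3 : (a * η X) • a • ξ = 0 := by
      rw [smul_smul, mul_right_comm, ha, zero_mul, zero_smul]
    have e4 : (a * (a * η X - a * η X * 1)) = 0 := by ring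
    rw [e3, e4]
    module
  g_compat X Y := by
    have e2 := h.ηφ X
    have e3 := h.ηφ Y
    have ha := h.aa
    have := h.g_compat X Y
    simp only [h.g_sub_left, h.g_sub_right, h.g_smul_left, h.g_smul_right, h.gξ, h.gξ', h.η_ξ]
    rw [e2, e3]
    linear_combination this - (η X * η Y) * ha

theorem red_AqS (h : IsACMS φ ξ η g) (hA : IsAqS C φ ξ η g) :
    IsAqS C (fun X => φ X - (η (φ ξ) * η X) • ξ) ξ η g := by
  constructor
  · intro X Y Z
    have h1 := hA.1 X Y Z
    simp only [VFCalc.d2, fund, h.g_sub_right, h.g_smul_right, h.gξ, mul_assoc, C.act_sub,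
      red_af h hA] at h1 ⊢
    linear_combination h1 + η Z * red_ω h hA X Y - η Y * red_ω h hA X Z + η X * red_ω h hA Y Z
  · intro X Y
    have h1 := hA.2 X Y
    rw [← h1]
    have e1 := red_a1 h hA X
    have e2 := red_a1 h hA Y
    simp only [VFCalc.nij, C.lie_sub_left, C.lie_sub_right, red_lie h hA, red_lie_left h hA,
      h.φ_sub, h.φ_smul, h.η_sub, h.η_smul, h.η_ξ, mul_sub, red_ω h hA]
    rw [h.ηφ (C.lie X Y)]
    have e3 : φ ξ = η (φ ξ) • ξ := h.φξ'
    have e5 : C.lie ξ ξ = 0 := by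
      have := red_lie h hA ξ ξ 1
      have h6 := C.lie_skew ξ ξ
      have h7 : (2:F) • C.lie ξ ξ = 0 := by
        rw [two_smul]; nth_rw 1 [h6]; simp
      have h2 : algebraMap ℝ F (1/2) * 2 = 1 := by
        rw [← map_ofNat (algebraMap ℝ F) 2, ← map_mul]; norm_num
      calc C.lie ξ ξ = (algebraMap ℝ F (1/2) * 2) • C.lie ξ ξ := by rw [h2, one_smul]
        _ = 0 := by rw [mul_smul, h7, smul_zero]
    have e6 := C.lie_skew ξ (φ Y)
    have e7 := C.lie_skew ξ Y
    rw [e5, e6, e7, h.φ_neg]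
    have f1 : (η (φ ξ) * η (C.lie X Y)) • φ ξ = 0 := by rw [red_ω h hA, zero_smul]
    have f2 : ∀ Z, (η (φ ξ) * η Z) • C.lie (φ X) ξ = (η (φ ξ) * η Z) • φ (C.lie X ξ) := by
      intro Z; rw [mul_comm, mul_smul, mul_smul, e1]
    have f3 : ∀ Z, (η (φ ξ) * η Z) • C.lie (φ Y) ξ = (η (φ ξ) * η Z) • φ (C.lie Y ξ) := by
      intro Z; rw [mul_comm, mul_smul, mul_smul, e2]
    have f4 : ∀ x, η (φ ξ) * (η (φ ξ) * x) = 0 := by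
      intro x
      rw [← mul_assoc, h.aa, zero_mul]
    simp only [f2, f3, smul_neg, mul_assoc, f4, zero_smul, smul_zero, mul_zero, zero_mul, sub_zero, red_ω h hA]
    module
end Reduction

/-- The hypotheses of the theorem, together with `φ ξ = 0`. -/
structure Core {F V : Type} [CommRing F] [Algebra ℝ F] [AddCommGroup V] [Module F V]
    (C : VFCalc F V) (φ : V → V) (ξ : V) (η : V → F) (g : V → V → F) (D : V → V → V) : Prop where
  m : IsACMS φ ξ η g
  nd : ∀ X, (∀ Y, g X Y = 0) → X = 0
  lc : IsLeviCivita C g D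
  aq : IsAqS C φ ξ η g
  φξ : φ ξ = 0

/-- `ψ = -∇ξ` -/
def ps {V : Type} [AddCommGroup V] (D : V → V → V) (ξ : V) (X : V) : V := - D X ξ

namespace Core
variable {F V : Type} [CommRing F] [Algebra ℝ F] [AddCommGroup V] [Module F V]
variable {C : VFCalc F V} {φ : V → V} {ξ : V} {η : V → F} {g : V → V → F} {D : V → V → V}
variable (k : Core C φ ξ η g D)
include k

theorem ext (X Y : V) (h : ∀ Z, g X Z = g Y Z) : X = Y := by
  have := k.nd (X - Y) (fun Z => by rw [k.m.g_sub_left, h, sub_self])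
  exact sub_eq_zero.mp this
theorem ηφ (X : V) : η (φ X) = 0 := by rw [k.m.ηφ, k.φξ, k.m.η_zero, zero_mul]
theorem skew (X Y : V) : g (φ X) Y = - g X (φ Y) := by
  have := k.m.skew' X Y
  rw [k.φξ, k.m.η_zero] at this
  linear_combination this
theorem Dξ_ξ (X : V) : g (D X ξ) ξ = 0 := by
  have h := k.lc.metric X ξ ξ
  rw [k.m.gξ, k.m.η_ξ, C.act_one, k.m.g_symm ξ] at h
  apply two_cancel'
  linear_combination -h
theorem kill0 (X Y : V) : g (D X ξ) (φ Y) + g X (D (φ Y) ξ) = 0 := by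
  have h := red_h k.m k.aq X Y
  rw [k.φξ, k.m.η_zero, zero_mul, k.lc.metric, ← k.lc.torsion_free, ← k.lc.torsion_free] at h
  simp only [k.m.g_add_left, k.m.g_add_right, k.m.g_sub_left, k.m.g_sub_right,
    k.m.g_neg_left, k.m.g_neg_right, k.m.g_smul_left, k.m.g_smul_right, k.m.g_zero_left, k.m.g_zero_right,
    k.m.φ_add, k.m.φ_sub, k.m.φ_neg, k.m.φ_smul, k.m.φ_zero, k.m.η_add, k.m.η_sub, k.m.η_neg, k.m.η_smul, k.m.η_zero] at h
  linear_combination h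
theorem kill1 (X : V) : g X (D ξ ξ) = 0 := by
  have h := red_dη k.m k.aq X
  rw [VFCalc.d1, k.m.η_ξ, C.act_one, ← k.m.gξ, ← k.m.gξ, ← k.lc.torsion_free, k.lc.metric,
    k.m.g_sub_left, k.Dξ_ξ] at h
  linear_combination -h
theorem Dξξ : D ξ ξ = 0 := k.nd _ (fun Y => by rw [k.m.g_symm, k.kill1])
theorem kill (X Y : V) : g (D X ξ) Y + g X (D Y ξ) = 0 := by
  have h := k.kill0 X (φ Y)
  simp only [k.m.φ_sq, k.m.g_add_left, k.m.g_add_right, k.m.g_sub_left, k.m.g_sub_right,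
    k.m.g_neg_left, k.m.g_neg_right, k.m.g_smul_left, k.m.g_smul_right, k.m.g_zero_left, k.m.g_zero_right,
    k.m.φ_add, k.m.φ_sub, k.m.φ_neg, k.m.φ_smul, k.m.φ_zero, k.m.η_add, k.m.η_sub, k.m.η_neg, k.m.η_smul, k.m.η_zero, k.lc.add_left, k.lc.neg_left, k.lc.smul_left, k.Dξ_ξ, k.Dξξ] at h
  linear_combination -h

theorem ps_add (X Y : V) : ps D ξ (X + Y) = ps D ξ X + ps D ξ Y := by
  simp only [ps, k.lc.add_left]; abel
theorem ps_smul (f : F) (X : V) : ps D ξ (f • X) = f • ps D ξ X := by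
  simp only [ps, k.lc.smul_left, smul_neg]
theorem ps_neg (X : V) : ps D ξ (-X) = - ps D ξ X := by
  simp only [ps, k.lc.neg_left]
theorem ps_ξ : ps D ξ ξ = 0 := by simp only [ps, k.Dξξ, neg_zero]
theorem ps_skew (X Y : V) : g (ps D ξ X) Y = - g X (ps D ξ Y) := by
  simp only [ps, k.m.g_add_left, k.m.g_add_right, k.m.g_sub_left, k.m.g_sub_right,
    k.m.g_neg_left, k.m.g_neg_right, k.m.g_smul_left, k.m.g_smul_right, k.m.g_zero_left, k.m.g_zero_right,
    k.m.φ_add, k.m.φ_sub, k.m.φ_neg, k.m.φ_smul, k.m.φ_zero, k.m.η_add, k.m.η_sub, k.m.η_neg, k.m.η_smul, k.m.η_zero]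
  linear_combination -k.kill X Y
theorem η_ps (X : V) : η (ps D ξ X) = 0 := by
  rw [← k.m.gξ, k.ps_skew, k.ps_ξ, k.m.g_zero_right, neg_zero]
theorem Dξ (X : V) : D X ξ = - ps D ξ X := by simp [ps]
theorem actη (X Y : V) : C.act X (η Y) = η (D X Y) - g Y (ps D ξ X) := by
  rw [← k.m.gξ, k.lc.metric, k.Dξ, k.m.g_neg_right, k.m.gξ]; ring
theorem η_lie (X Y : V) : η (C.lie (φ X) (φ Y)) = C.d1 η X Y := by
  have h := congrArg η (red_E k.aq X Y)
  simpa only [k.m.g_add_left, k.m.g_add_right, k.m.g_sub_left, k.m.g_sub_right,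
    k.m.g_neg_left, k.m.g_neg_right, k.m.g_smul_left, k.m.g_smul_right, k.m.g_zero_left, k.m.g_zero_right,
    k.m.φ_add, k.m.φ_sub, k.m.φ_neg, k.m.φ_smul, k.m.φ_zero, k.m.η_add, k.m.η_sub, k.m.η_neg, k.m.η_smul, k.m.η_zero, k.ηφ, k.m.η_ξ, mul_one, add_zero, sub_zero] using h
theorem dη (X Y : V) : C.d1 η X Y = - 2 * g (ps D ξ X) Y := by
  rw [VFCalc.d1, k.actη, k.actη, ← k.lc.torsion_free, k.m.η_sub, k.m.g_symm Y, ← neg_eq_iff_eq_neg.mpr (k.ps_skew X Y)]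
  ring
theorem anti0 (X Y : V) : g (ps D ξ (φ X)) (φ Y) = - g (ps D ξ X) Y := by
  have h1 := k.dη (φ X) (φ Y)
  have h2 := k.dη X Y
  rw [VFCalc.d1, k.ηφ, k.ηφ, k.η_lie, C.act_zero, C.act_zero] at h1
  have : 2 * (g (ps D ξ (φ X)) (φ Y) + g (ps D ξ X) Y) = 0 := by
    linear_combination h1 + h2
  linear_combination two_cancel' _ this
theorem anti (X : V) : ps D ξ (φ X) = - φ (ps D ξ X) := by
  apply k.ext
  intro Y
  have h := k.anti0 X (φ Y)
  rw [k.m.φ_sq] at h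
  simp only [k.m.g_add_left, k.m.g_add_right, k.m.g_sub_left, k.m.g_sub_right,
    k.m.g_neg_left, k.m.g_neg_right, k.m.g_smul_left, k.m.g_smul_right, k.m.g_zero_left, k.m.g_zero_right,
    k.m.φ_add, k.m.φ_sub, k.m.φ_neg, k.m.φ_smul, k.m.φ_zero, k.m.η_add, k.m.η_sub, k.m.η_neg, k.m.η_smul, k.m.η_zero, k.m.gξ, k.η_ps, k.skew] at h ⊢
  linear_combination -h

theorem A_skew (X Y : V) : g (ps D ξ (φ X)) Y = - g (ps D ξ (φ Y)) X := by
  rw [k.anti, k.m.g_neg_left, k.skew, k.ps_skew, k.m.g_symm]; ring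
theorem A_skew' (X Y : V) : g (ps D ξ X) (φ Y) = - g (ps D ξ (φ Y)) X := by
  rw [k.ps_skew, k.m.g_symm]
theorem B_skew (X Y : V) : g (ps D ξ (φ X)) (ps D ξ Y) = - g (ps D ξ (φ Y)) (ps D ξ X) := by
  rw [k.anti, k.m.g_neg_left, k.skew, k.m.g_symm, ← neg_eq_iff_eq_neg.mpr (k.anti Y)]
  simp only [k.m.g_add_left, k.m.g_add_right, k.m.g_sub_left, k.m.g_sub_right,
    k.m.g_neg_left, k.m.g_neg_right, k.m.g_smul_left, k.m.g_smul_right, k.m.g_zero_left, k.m.g_zero_right,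
    k.m.φ_add, k.m.φ_sub, k.m.φ_neg, k.m.φ_smul, k.m.φ_zero, k.m.η_add, k.m.η_sub, k.m.η_neg, k.m.η_smul, k.m.η_zero]
  ring

end Core

/-- `g((∇_X φ)Y, Z)` -/
def TT {F V : Type} [CommRing F] (g : V → V → F) (φ : V → V) (D : V → V → V) (X Y Z : V) : F :=
  g (D X (φ Y)) Z + g (D X Y) (φ Z)

namespace Core
variable {F V : Type} [CommRing F] [Algebra ℝ F] [AddCommGroup V] [Module F V]
variable {C : VFCalc F V} {φ : V → V} {ξ : V} {η : V → F} {g : V → V → F} {D : V → V → V}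
variable (k : Core C φ ξ η g D)
include k

theorem T_skew (X Y Z : V) : TT g φ D X Y Z = - TT g φ D X Z Y := by
  have h1 := k.lc.metric X (φ Y) Z
  have h2 := k.lc.metric X Y (φ Z)
  rw [k.skew, C.act_neg] at h1
  simp only [TT, k.m.g_symm _ Y, k.m.g_symm _ (φ Y)] at *
  linear_combination -h1 - h2
theorem T_cyc (X Y Z : V) : TT g φ D X Y Z + TT g φ D Y Z X + TT g φ D Z X Y = 0 := by
  have h := k.aq.1 X Y Z
  have h1 := k.T_skew X Y Z
  have h2 := k.T_skew Y Z X
  have h3 := k.T_skew Z X Y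
  simp only [VFCalc.d2, fund, k.lc.metric, ← k.lc.torsion_free, k.m.g_add_left, k.m.g_add_right, k.m.g_sub_left, k.m.g_sub_right,
    k.m.g_neg_left, k.m.g_neg_right, k.m.g_smul_left, k.m.g_smul_right, k.m.g_zero_left, k.m.g_zero_right,
    k.m.φ_add, k.m.φ_sub, k.m.φ_neg, k.m.φ_smul, k.m.φ_zero, k.m.η_add, k.m.η_sub, k.m.η_neg, k.m.η_smul, k.m.η_zero] at h
  simp only [TT, k.m.g_symm _ X, k.m.g_symm _ Y, k.m.g_symm _ Z] at *
  linear_combination -h + h1 + h3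
theorem T_nij (X Y Z : V) : TT g φ D (φ Y) Z (φ X) - TT g φ D (φ Z) Y (φ X) - TT g φ D Y Z X
    + η X * TT g φ D Y Z ξ + TT g φ D Z Y X - η X * TT g φ D Z Y ξ = 0 := by
  have h := congrArg (fun v => g v (φ X)) (red_E k.aq Y Z)
  simp only [← k.lc.torsion_free, k.m.g_add_left, k.m.g_add_right, k.m.g_sub_left, k.m.g_sub_right,
    k.m.g_neg_left, k.m.g_neg_right, k.m.g_smul_left, k.m.g_smul_right, k.m.g_zero_left, k.m.g_zero_right,
    k.m.φ_add, k.m.φ_sub, k.m.φ_neg, k.m.φ_smul, k.m.φ_zero, k.m.η_add, k.m.η_sub, k.m.η_neg, k.m.η_smul, k.m.η_zero, k.m.g_compat, k.m.gξ', k.ηφ] at h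
  simp only [TT, k.m.φ_sq, k.φξ, k.m.g_add_left, k.m.g_add_right, k.m.g_sub_left, k.m.g_sub_right,
    k.m.g_neg_left, k.m.g_neg_right, k.m.g_smul_left, k.m.g_smul_right, k.m.g_zero_left, k.m.g_zero_right,
    k.m.φ_add, k.m.φ_sub, k.m.φ_neg, k.m.φ_smul, k.m.φ_zero, k.m.η_add, k.m.η_sub, k.m.η_neg, k.m.η_smul, k.m.η_zero, k.m.gξ]
  have e1 := k.skew (D Y Z) X
  have e2 := k.skew (D Z Y) X
  linear_combination h - e1 + e2
theorem T_move (X Y Z : V) : TT g φ D X (φ Y) Z - TT g φ D X Y (φ Z) =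
    - g (ps D ξ X) Y * η Z - η Y * g (ps D ξ X) Z := by
  simp only [TT, k.m.φ_sq, k.lc.add_right, k.lc.neg_right, k.lc.leibniz, k.m.g_add_left, k.m.g_add_right, k.m.g_sub_left, k.m.g_sub_right,
    k.m.g_neg_left, k.m.g_neg_right, k.m.g_smul_left, k.m.g_smul_right, k.m.g_zero_left, k.m.g_zero_right,
    k.m.φ_add, k.m.φ_sub, k.m.φ_neg, k.m.φ_smul, k.m.φ_zero, k.m.η_add, k.m.η_sub, k.m.η_neg, k.m.η_smul, k.m.η_zero, k.actη, k.m.gξ,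
    k.m.gξ', k.Dξ, k.m.g_symm Y]
  ring
theorem T_ξ (X Y : V) : TT g φ D X Y ξ = - g (ps D ξ (φ Y)) X := by
  have h := k.actη X (φ Y)
  rw [k.ηφ, C.act_zero] at h
  rw [TT, k.φξ, k.m.g_zero_right, k.m.gξ]
  rw [k.m.g_symm] at h
  linear_combination -h + k.A_skew' X Y
theorem T_φφ (X Y Z : V) : TT g φ D X Y (φ (φ Z)) = - TT g φ D X Y Z + η Z * TT g φ D X Y ξ := by
  simp only [TT, k.m.φ_sq, k.m.g_add_left, k.m.g_add_right, k.m.g_sub_left, k.m.g_sub_right,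
    k.m.g_neg_left, k.m.g_neg_right, k.m.g_smul_left, k.m.g_smul_right, k.m.g_zero_left, k.m.g_zero_right,
    k.m.φ_add, k.m.φ_sub, k.m.φ_neg, k.m.φ_smul, k.m.φ_zero, k.m.η_add, k.m.η_sub, k.m.η_neg, k.m.η_smul, k.m.η_zero, k.φξ]
  ring
theorem T_eq (X Y Z : V) : TT g φ D X Y Z = -2 * η X * g (ps D ξ (φ Y)) Z
    - η Y * g (ps D ξ (φ X)) Z - g (ps D ξ (φ Y)) X * η Z := by
  have h1 := k.T_nij X Y Z
  have h2 := k.T_move (φ Y) Z X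
  have h3 := k.T_move (φ Z) Y X
  have h4 := k.T_cyc X (φ Y) (φ Z)
  have h5 := k.T_move X Y (φ Z)
  have h6 := k.T_φφ X Y Z
  have h7 := k.T_cyc X Y Z
  have h8 := k.T_skew (φ Z) X (φ Y)
  have h9 := k.T_skew Z X Y
  rw [k.T_ξ, k.T_ξ] at h1
  rw [k.T_ξ] at h6
  rw [k.ηφ, k.A_skew'] at h5
  have a1 := k.A_skew X Y
  have a2 := k.A_skew Y Z
  have a3 := k.A_skew Z X
  rw [k.A_skew Z Y, k.A_skew Z X] at *
  have : 2 * (TT g φ D X Y Z - (-2 * η X * g (ps D ξ (φ Y)) Z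
    - η Y * g (ps D ξ (φ X)) Z - g (ps D ξ (φ Y)) X * η Z)) = 0 := by
    linear_combination h1 + h2 - h3 - h4 + h5 + h6 + h7 + h8 - h9
  linear_combination two_cancel' _ this
end Core

/-- `g((∇_X ψ)Y, Z)` -/
def SS {F V : Type} [CommRing F] [AddCommGroup V] (g : V → V → F) (D : V → V → V) (ξ : V)
    (X Y Z : V) : F :=
  g (D X (ps D ξ Y)) Z + g (D X Y) (ps D ξ Z)

namespace Core
variable {F V : Type} [CommRing F] [Algebra ℝ F] [AddCommGroup V] [Module F V]
variable {C : VFCalc F V} {φ : V → V} {ξ : V} {η : V → F} {g : V → V → F} {D : V → V → V}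
variable (k : Core C φ ξ η g D)
include k

theorem Dφ (X Y : V) : D X (φ Y) = φ (D X Y) + ((-2 * η X) • ps D ξ (φ Y)
    - η Y • ps D ξ (φ X) - g (ps D ξ (φ Y)) X • ξ) := by
  apply k.ext
  intro Z
  have h := k.T_eq X Y Z
  rw [TT] at h
  simp only [k.m.g_add_left, k.m.g_add_right, k.m.g_sub_left, k.m.g_sub_right,
    k.m.g_neg_left, k.m.g_neg_right, k.m.g_smul_left, k.m.g_smul_right, k.m.g_zero_left, k.m.g_zero_right,
    k.m.φ_add, k.m.φ_sub, k.m.φ_neg, k.m.φ_smul, k.m.φ_zero, k.m.η_add, k.m.η_sub, k.m.η_neg, k.m.η_smul, k.m.η_zero, k.skew, k.m.gξ']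
  linear_combination h

theorem R1 (X Y Z : V) : C.curv D X Y Z = - C.curv D Y X Z := by
  simp only [VFCalc.curv]; rw [C.lie_skew X Y, k.lc.neg_left]; abel
theorem R2 (X Y Z W : V) : g (C.curv D X Y Z) W = - g (C.curv D X Y W) Z := by
  have h := C.act_lie X Y (g Z W)
  simp only [k.lc.metric, C.act_add] at h
  simp only [VFCalc.curv, k.m.g_add_left, k.m.g_add_right, k.m.g_sub_left, k.m.g_sub_right,
    k.m.g_neg_left, k.m.g_neg_right, k.m.g_smul_left, k.m.g_smul_right, k.m.g_zero_left, k.m.g_zero_right,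
    k.m.φ_add, k.m.φ_sub, k.m.φ_neg, k.m.φ_smul, k.m.φ_zero, k.m.η_add, k.m.η_sub, k.m.η_neg, k.m.η_smul, k.m.η_zero, k.m.g_symm _ Z] at h ⊢
  linear_combination -h
theorem R3 (X Y Z : V) : C.curv D X Y Z + C.curv D Y Z X + C.curv D Z X Y = 0 := by
  have h := C.lie_jacobi X Y Z
  rw [← k.lc.torsion_free X, ← k.lc.torsion_free Y (C.lie Z X),
    ← k.lc.torsion_free Z (C.lie X Y)] at h
  have e1 : D X (C.lie Y Z) = D X (D Y Z) - D X (D Z Y) := by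
    rw [← k.lc.torsion_free, k.lc.sub_right]
  have e2 : D Y (C.lie Z X) = D Y (D Z X) - D Y (D X Z) := by
    rw [← k.lc.torsion_free, k.lc.sub_right]
  have e3 : D Z (C.lie X Y) = D Z (D X Y) - D Z (D Y X) := by
    rw [← k.lc.torsion_free, k.lc.sub_right]
  rw [e1, e2, e3] at h
  simp only [VFCalc.curv]
  rw [← h]; abel
theorem R3g (X Y Z W : V) : g (C.curv D X Y Z) W + g (C.curv D Y Z X) W
    + g (C.curv D Z X Y) W = 0 := by
  have h := congrArg (fun v => g v W) (k.R3 X Y Z)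
  simpa only [k.m.g_add_left, k.m.g_add_right, k.m.g_sub_left, k.m.g_sub_right,
    k.m.g_neg_left, k.m.g_neg_right, k.m.g_smul_left, k.m.g_smul_right, k.m.g_zero_left, k.m.g_zero_right,
    k.m.φ_add, k.m.φ_sub, k.m.φ_neg, k.m.φ_smul, k.m.φ_zero, k.m.η_add, k.m.η_sub, k.m.η_neg, k.m.η_smul, k.m.η_zero] using h
theorem R1g (X Y Z W : V) : g (C.curv D X Y Z) W = - g (C.curv D Y X Z) W := by
  rw [k.R1, k.m.g_neg_left]
theorem R4 (X Y Z W : V) : g (C.curv D X Y Z) W = g (C.curv D Z W X) Y := by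
  have b1 := k.R3g X Y Z W
  have b2 := k.R3g Y Z W X
  have b3 := k.R3g Z W X Y
  have b4 := k.R3g W X Y Z
  rw [k.R2 Y Z W X, k.R2 Z W Y X, k.R1g W Y, k.R2 Y W Z X] at b2
  rw [k.R1g W X, k.R2 X W Z Y, k.R1g X Z, k.R2 Z X W Y] at b3
  rw [k.R1g W X Y Z, k.R2 X Y W Z] at b4
  have : 2 * (g (C.curv D X Y Z) W - g (C.curv D Z W X) Y) = 0 := by
    linear_combination b1 + b2 - b3 - b4
  linear_combination two_cancel' _ this
theorem R_add (X X' Y Z : V) : C.curv D (X + X') Y Z = C.curv D X Y Z + C.curv D X' Y Z := by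
  simp only [VFCalc.curv, C.lie_add_left, k.lc.add_left, k.lc.add_right]; abel
theorem R_smul (f : F) (X Y Z : V) : C.curv D (f • X) Y Z = f • C.curv D X Y Z := by
  simp only [VFCalc.curv, C.lie_smul_left, k.lc.add_left, k.lc.smul_left, k.lc.leibniz]
  module

theorem S_skew (X Y Z : V) : SS g D ξ X Y Z = - SS g D ξ X Z Y := by
  have h1 := k.lc.metric X (ps D ξ Y) Z
  have h2 := k.lc.metric X Y (ps D ξ Z)
  rw [k.ps_skew, C.act_neg] at h1
  simp only [SS, k.m.g_symm _ Y, k.m.g_symm _ (ps D ξ Y)] at *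
  linear_combination -h1 - h2
theorem S_self (X Y : V) : SS g D ξ X Y Y = 0 := by
  apply two_cancel'
  linear_combination k.S_skew X Y Y
theorem S_add1 (X X' Y Z : V) : SS g D ξ (X + X') Y Z = SS g D ξ X Y Z + SS g D ξ X' Y Z := by
  simp only [SS, k.lc.add_left, k.m.g_add_left, k.m.g_add_right, k.m.g_sub_left, k.m.g_sub_right,
    k.m.g_neg_left, k.m.g_neg_right, k.m.g_smul_left, k.m.g_smul_right, k.m.g_zero_left, k.m.g_zero_right,
    k.m.φ_add, k.m.φ_sub, k.m.φ_neg, k.m.φ_smul, k.m.φ_zero, k.m.η_add, k.m.η_sub, k.m.η_neg, k.m.η_smul, k.m.η_zero]; ring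
theorem S_smul1 (f : F) (X Y Z : V) : SS g D ξ (f • X) Y Z = f * SS g D ξ X Y Z := by
  simp only [SS, k.lc.smul_left, k.m.g_add_left, k.m.g_add_right, k.m.g_sub_left, k.m.g_sub_right,
    k.m.g_neg_left, k.m.g_neg_right, k.m.g_smul_left, k.m.g_smul_right, k.m.g_zero_left, k.m.g_zero_right,
    k.m.φ_add, k.m.φ_sub, k.m.φ_neg, k.m.φ_smul, k.m.φ_zero, k.m.η_add, k.m.η_sub, k.m.η_neg, k.m.η_smul, k.m.η_zero]; ring
theorem S_add3 (X Y Z Z' : V) : SS g D ξ X Y (Z + Z') = SS g D ξ X Y Z + SS g D ξ X Y Z' := by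
  simp only [SS, k.ps_add, k.m.g_add_left, k.m.g_add_right, k.m.g_sub_left, k.m.g_sub_right,
    k.m.g_neg_left, k.m.g_neg_right, k.m.g_smul_left, k.m.g_smul_right, k.m.g_zero_left, k.m.g_zero_right,
    k.m.φ_add, k.m.φ_sub, k.m.φ_neg, k.m.φ_smul, k.m.φ_zero, k.m.η_add, k.m.η_sub, k.m.η_neg, k.m.η_smul, k.m.η_zero]; ring
theorem S_smul3 (f : F) (X Y Z : V) : SS g D ξ X Y (f • Z) = f * SS g D ξ X Y Z := by
  simp only [SS, k.ps_smul, k.m.g_add_left, k.m.g_add_right, k.m.g_sub_left, k.m.g_sub_right,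
    k.m.g_neg_left, k.m.g_neg_right, k.m.g_smul_left, k.m.g_smul_right, k.m.g_zero_left, k.m.g_zero_right,
    k.m.φ_add, k.m.φ_sub, k.m.φ_neg, k.m.φ_smul, k.m.φ_zero, k.m.η_add, k.m.η_sub, k.m.η_neg, k.m.η_smul, k.m.η_zero]; ring
theorem Rξ (X Y Z : V) : g (C.curv D X Y ξ) Z = - SS g D ξ X Y Z + SS g D ξ Y X Z := by
  have e1 := k.ps_skew (D X Y) Z
  have e2 := k.ps_skew (D Y X) Z
  simp only [VFCalc.curv, ← k.lc.torsion_free, k.lc.sub_left, k.Dξ, k.lc.neg_right, k.m.g_add_left, k.m.g_add_right, k.m.g_sub_left, k.m.g_sub_right,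
    k.m.g_neg_left, k.m.g_neg_right, k.m.g_smul_left, k.m.g_smul_right, k.m.g_zero_left, k.m.g_zero_right,
    k.m.φ_add, k.m.φ_sub, k.m.φ_neg, k.m.φ_smul, k.m.φ_zero, k.m.η_add, k.m.η_sub, k.m.η_neg, k.m.η_smul, k.m.η_zero, SS]
  linear_combination e1 - e2
theorem S_cyc (X Y Z : V) : SS g D ξ X Y Z + SS g D ξ Y Z X + SS g D ξ Z X Y = 0 := by
  have h := k.R3g X Y Z ξ
  rw [k.R2 X Y, k.R2 Y Z, k.R2 Z X, k.Rξ, k.Rξ, k.Rξ, k.S_skew Y X Z, k.S_skew Z Y X,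
    k.S_skew X Z Y] at h
  apply two_cancel'
  linear_combination h
theorem S_move (X Y Z : V) : SS g D ξ X (φ Y) Z - SS g D ξ X Y (φ Z) =
    - η Y * g (ps D ξ (φ X)) (ps D ξ Z) - η Z * g (ps D ξ (φ X)) (ps D ξ Y) := by
  have e0 : ∀ W, φ (ps D ξ W) = - ps D ξ (φ W) := fun W => by rw [k.anti, neg_neg]
  have e1 : ps D ξ (φ Y) = - φ (ps D ξ Y) := k.anti Y
  have e4 := k.B_skew X Y
  have e7 : g (D X (ps D ξ (φ Y))) Z = - g (φ (D X (ps D ξ Y)) + ((-2 * η X) • ps D ξ (φ (ps D ξ Y))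
    - η (ps D ξ Y) • ps D ξ (φ X) - g (ps D ξ (φ (ps D ξ Y))) X • ξ)) Z := by
    rw [← k.Dφ, e0, k.lc.neg_right, k.m.g_neg_left, neg_neg]
  rw [SS, e7]
  simp only [SS, k.Dφ, k.m.g_add_left, k.m.g_add_right, k.m.g_sub_left, k.m.g_sub_right,
    k.m.g_neg_left, k.m.g_neg_right, k.m.g_smul_left, k.m.g_smul_right, k.m.g_zero_left, k.m.g_zero_right,
    k.m.φ_add, k.m.φ_sub, k.m.φ_neg, k.m.φ_smul, k.m.φ_zero, k.m.η_add, k.m.η_sub, k.m.η_neg, k.m.η_smul, k.m.η_zero, k.skew, k.m.gξ', k.η_ps, e0, k.ps_neg]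
  have e5 := k.ps_skew (ps D ξ (φ Y)) X
  have e6 := k.ps_skew (ps D ξ (φ Y)) Z
  linear_combination η Z * e4 - η Z * e5 - 2 * η X * e6
theorem S_ξξ (Z : V) : SS g D ξ ξ ξ Z = 0 := by
  simp only [SS, k.ps_ξ, k.lc.zero_right, k.Dξξ, k.m.g_add_left, k.m.g_add_right, k.m.g_sub_left, k.m.g_sub_right,
    k.m.g_neg_left, k.m.g_neg_right, k.m.g_smul_left, k.m.g_smul_right, k.m.g_zero_left, k.m.g_zero_right,
    k.m.φ_add, k.m.φ_sub, k.m.φ_neg, k.m.φ_smul, k.m.φ_zero, k.m.η_add, k.m.η_sub, k.m.η_neg, k.m.η_smul, k.m.η_zero]; ring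

section frame
variable {d : ℕ} {e : Fin d → V} (hf : ∀ X, X = ∑ i, g X (e i) • e i)
include hf

theorem sum_lin (f : V → F) (h1 : ∀ X Y, f (X + Y) = f X + f Y) (h2 : ∀ (a : F) X, f (a • X) = a * f X)
    (X : V) : ∑ i, g X (e i) * f (e i) = f X := by
  let L : V →ₗ[F] F := { toFun := f, map_add' := h1, map_smul' := h2 }
  have : L X = ∑ i, g X (e i) * f (e i) := by
    conv_lhs => rw [hf X]
    rw [map_sum]; simp [L, h2]
  exact this.symm

theorem trans (b : V → V → F) (h1 : ∀ X Y Z, b (X + Y) Z = b X Z + b Y Z)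
    (h2 : ∀ (a : F) X Z, b (a • X) Z = a * b X Z) (h3 : ∀ X Y Z, b X (Y + Z) = b X Y + b X Z)
    (h4 : ∀ (a : F) X Z, b X (a • Z) = a * b X Z) (A A' : V → V)
    (h : ∀ X Y, g (A X) Y = g X (A' Y)) : ∑ i, b (A (e i)) (e i) = ∑ i, b (e i) (A' (e i)) := by
  have s1 : ∀ i, b (A (e i)) (e i) = ∑ j, g (A (e i)) (e j) * b (e j) (e i) := fun i =>
    (k.sum_lin hf (fun W => b W (e i)) (fun X Y => h1 X Y _) (fun a X => h2 a X _) _).symm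
  have s2 : ∀ i, b (e i) (A' (e i)) = ∑ j, g (A' (e i)) (e j) * b (e i) (e j) := fun i =>
    (k.sum_lin hf (fun W => b (e i) W) (fun X Y => h3 _ X Y) (fun a X => h4 a _ X) _).symm
  simp only [s1, s2]
  rw [Finset.sum_comm]
  refine Finset.sum_congr rfl fun i _ => Finset.sum_congr rfl fun j _ => ?_
  rw [h, k.m.g_symm]

theorem sum_η (f : V → F) (h1 : ∀ X Y, f (X + Y) = f X + f Y)
    (h2 : ∀ (a : F) X, f (a • X) = a * f X) : ∑ i, η (e i) * f (e i) = f ξ := by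
  rw [← k.sum_lin hf f h1 h2 ξ]
  simp only [k.m.gξ']

theorem s_φ (Z : V) : ∑ i, SS g D ξ (e i) (e i) (φ Z) = 0 := by
  have hB : ∀ W, ∑ i, η (e i) * g (ps D ξ (φ W)) (ps D ξ (e i)) = 0 := fun W => by
    rw [k.sum_η hf (fun U => g (ps D ξ (φ W)) (ps D ξ U))]
    · simp only [k.ps_ξ, k.m.g_add_left, k.m.g_add_right, k.m.g_sub_left, k.m.g_sub_right,
    k.m.g_neg_left, k.m.g_neg_right, k.m.g_smul_left, k.m.g_smul_right, k.m.g_zero_left, k.m.g_zero_right,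
    k.m.φ_add, k.m.φ_sub, k.m.φ_neg, k.m.φ_smul, k.m.φ_zero, k.m.η_add, k.m.η_sub, k.m.η_neg, k.m.η_smul, k.m.η_zero]
    · intro X Y; simp only [k.ps_add, k.m.g_add_left, k.m.g_add_right, k.m.g_sub_left, k.m.g_sub_right,
    k.m.g_neg_left, k.m.g_neg_right, k.m.g_smul_left, k.m.g_smul_right, k.m.g_zero_left, k.m.g_zero_right,
    k.m.φ_add, k.m.φ_sub, k.m.φ_neg, k.m.φ_smul, k.m.φ_zero, k.m.η_add, k.m.η_sub, k.m.η_neg, k.m.η_smul, k.m.η_zero]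
    · intro a X; simp only [k.ps_smul, k.m.g_add_left, k.m.g_add_right, k.m.g_sub_left, k.m.g_sub_right,
    k.m.g_neg_left, k.m.g_neg_right, k.m.g_smul_left, k.m.g_smul_right, k.m.g_zero_left, k.m.g_zero_right,
    k.m.φ_add, k.m.φ_sub, k.m.φ_neg, k.m.φ_smul, k.m.φ_zero, k.m.η_add, k.m.η_sub, k.m.η_neg, k.m.η_smul, k.m.η_zero]
  have hB' : ∀ W, ∑ i, η (e i) * g (ps D ξ (φ (e i))) (ps D ξ W) = 0 := fun W => by
    simp only [fun i => k.B_skew (e i) W, mul_neg, Finset.sum_neg_distrib, hB, neg_zero]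
  have p0 : ∀ i, g (ps D ξ (φ (e i))) (ps D ξ (e i)) = 0 := fun i => by
    apply two_cancel'; linear_combination k.B_skew (e i) (e i)
  have p1 : ∑ i, SS g D ξ (e i) (e i) (φ Z) = ∑ i, SS g D ξ (e i) (φ (e i)) Z := by
    rw [← add_zero (∑ i, SS g D ξ (e i) (φ (e i)) Z), ← hB' Z, ← Finset.sum_add_distrib]
    refine Finset.sum_congr rfl fun i _ => ?_
    linear_combination - k.S_move (e i) (e i) Z + η Z * p0 i
  have p2 : ∑ i, SS g D ξ (φ (e i)) Z (e i) = ∑ i, SS g D ξ (e i) (φ (e i)) Z := by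
    rw [k.trans hf (fun X W => SS g D ξ X Z W) (fun X Y W => k.S_add1 X Y Z W)
      (fun a X W => k.S_smul1 a X Z W) (fun X Y W => k.S_add3 X Z Y W)
      (fun a X W => k.S_smul3 a X Z W) φ (fun X => φ ((-1 : F) • X))
      (fun X Y => by rw [k.skew, k.m.φ_smul, k.m.g_smul_right]; ring)]
    refine Finset.sum_congr rfl fun i _ => ?_
    rw [k.m.φ_smul, k.S_smul3, k.S_skew]; ring
  have p3 : ∑ i, SS g D ξ Z (e i) (φ (e i)) = 0 := by
    rw [← hB Z]
    refine Finset.sum_congr rfl fun i _ => ?_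
    have : 2 * (SS g D ξ Z (e i) (φ (e i)) - η (e i) * g (ps D ξ (φ Z)) (ps D ξ (e i))) = 0 := by
      linear_combination - k.S_move Z (e i) (e i) + k.S_skew Z (φ (e i)) (e i)
    linear_combination two_cancel' _ this
  have p4 : ∑ i, SS g D ξ (e i) (φ (e i)) Z + ∑ i, SS g D ξ (φ (e i)) Z (e i)
      + ∑ i, SS g D ξ Z (e i) (φ (e i)) = 0 := by
    rw [← Finset.sum_add_distrib, ← Finset.sum_add_distrib]
    exact Finset.sum_eq_zero fun i _ => k.S_cyc _ _ _
  apply two_cancel'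
  linear_combination 2 * p1 + p4 - p2 - p3

omit hf in
theorem ric_symm (X Y : V) : ricci C D g e X Y = ricci C D g e Y X := by
  refine Finset.sum_congr rfl fun i _ => ?_
  rw [k.R4, k.R1g, k.R2, neg_neg]

omit hf in
theorem ric_S (X : V) : ricci C D g e X ξ = ∑ i, SS g D ξ (e i) (e i) X := by
  refine Finset.sum_congr rfl fun i _ => ?_
  rw [k.Rξ, k.S_self, k.S_skew]; ring

omit hf in
theorem ric_ξξ : ricci C D g e ξ ξ = ∑ i, g (ps D ξ (e i)) (ps D ξ (e i)) := by
  rw [k.ric_S]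
  refine Finset.sum_congr rfl fun i _ => ?_
  rw [k.S_skew, SS, k.ps_ξ, k.lc.zero_right, k.Dξ]
  simp only [k.m.g_add_left, k.m.g_add_right, k.m.g_sub_left, k.m.g_sub_right,
    k.m.g_neg_left, k.m.g_neg_right, k.m.g_smul_left, k.m.g_smul_right, k.m.g_zero_left, k.m.g_zero_right,
    k.m.φ_add, k.m.φ_sub, k.m.φ_neg, k.m.φ_smul, k.m.φ_zero, k.m.η_add, k.m.η_sub, k.m.η_neg, k.m.η_smul, k.m.η_zero]; ring

theorem ric_ξ (X : V) : ricci C D g e X ξ = η X * ∑ i, g (ps D ξ (e i)) (ps D ξ (e i)) := by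
  have e1 : X = φ ((-1 : F) • φ X) + η X • ξ := by
    rw [k.m.φ_smul, k.m.φ_sq]; module
  rw [← k.ric_ξξ, k.ric_S, k.ric_S]
  conv_lhs => rw [e1]
  simp only [k.S_add3, k.S_smul3]
  rw [Finset.sum_add_distrib, k.s_φ hf, Finset.mul_sum, zero_add]
end frame
end Core

/-- covariant derivative of `A = ψφ` -/
def DA {V : Type} [AddCommGroup V] (φ : V → V) (D : V → V → V) (ξ : V) (X Y : V) : V :=
  D X (ps D ξ (φ Y)) - ps D ξ (φ (D X Y))

/-- auxiliary tensor in the formula for `R(X,Y)φZ` -/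
def MM {F V : Type} [CommRing F] [AddCommGroup V] [Module F V] (φ : V → V) (ξ : V) (η : V → F)
    (g : V → V → F) (D : V → V → V) (X Y Z : V) : V :=
  (2 * g Y (ps D ξ X)) • ps D ξ (φ Z) - (2 * η Y) • DA φ D ξ X Z + g Z (ps D ξ X) • ps D ξ (φ Y)
    - η Z • DA φ D ξ X Y - g (DA φ D ξ X Z) Y • ξ + g (ps D ξ (φ Z)) Y • ps D ξ X

namespace Core
variable {F V : Type} [CommRing F] [Algebra ℝ F] [AddCommGroup V] [Module F V]
variable {C : VFCalc F V} {φ : V → V} {ξ : V} {η : V → F} {g : V → V → F} {D : V → V → V}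
variable (k : Core C φ ξ η g D)
include k

theorem act2 (X : V) (f : F) : C.act X (-2 * f) = -2 * C.act X f := by
  have : -2 * f = -(f + f) := by ring
  rw [this, C.act_neg, C.act_add]; ring

theorem ps_sub (X Y : V) : ps D ξ (X - Y) = ps D ξ X - ps D ξ Y := by
  simp only [ps, k.lc.sub_left]; abel

theorem DDφ (X Y Z : V) : D X (D Y (φ Z)) = φ (D X (D Y Z)) + ((-2 * η X) • ps D ξ (φ (D Y Z))
    - η (D Y Z) • ps D ξ (φ X) - g (ps D ξ (φ (D Y Z))) X • ξ)
    + ((-2 * (η (D X Y) - g Y (ps D ξ X))) • ps D ξ (φ Z) + (-2 * η Y) • D X (ps D ξ (φ Z))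
    - ((η (D X Z) - g Z (ps D ξ X)) • ps D ξ (φ Y) + η Z • D X (ps D ξ (φ Y)))
    - ((g (D X (ps D ξ (φ Z))) Y + g (ps D ξ (φ Z)) (D X Y)) • ξ
      - g (ps D ξ (φ Z)) Y • ps D ξ X)) := by
  rw [k.Dφ Y Z, k.lc.add_right, k.Dφ X (D Y Z)]
  simp only [k.lc.sub_right, k.lc.leibniz, k.act2, k.actη, k.lc.metric, k.Dξ, smul_neg]
  module

theorem Rφ (X Y Z : V) : C.curv D X Y (φ Z) = φ (C.curv D X Y Z) + MM φ ξ η g D X Y Z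
    - MM φ ξ η g D Y X Z := by
  rw [VFCalc.curv, k.DDφ, k.DDφ, k.Dφ]
  simp only [VFCalc.curv, MM, DA, ← k.lc.torsion_free, k.lc.sub_left, k.ps_sub, k.m.g_add_left, k.m.g_add_right, k.m.g_sub_left, k.m.g_sub_right,
    k.m.g_neg_left, k.m.g_neg_right, k.m.g_smul_left, k.m.g_smul_right, k.m.g_zero_left, k.m.g_zero_right,
    k.m.φ_add, k.m.φ_sub, k.m.φ_neg, k.m.φ_smul, k.m.φ_zero, k.m.η_add, k.m.η_sub, k.m.η_neg, k.m.η_smul, k.m.η_zero]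
  module

theorem DA_add1 (X X' Y : V) : DA φ D ξ (X + X') Y = DA φ D ξ X Y + DA φ D ξ X' Y := by
  simp only [DA, k.lc.add_left, k.m.g_add_left, k.m.g_add_right, k.m.g_sub_left, k.m.g_sub_right,
    k.m.g_neg_left, k.m.g_neg_right, k.m.g_smul_left, k.m.g_smul_right, k.m.g_zero_left, k.m.g_zero_right,
    k.m.φ_add, k.m.φ_sub, k.m.φ_neg, k.m.φ_smul, k.m.φ_zero, k.m.η_add, k.m.η_sub, k.m.η_neg, k.m.η_smul, k.m.η_zero, k.ps_add]; abel
theorem DA_smul1 (f : F) (X Y : V) : DA φ D ξ (f • X) Y = f • DA φ D ξ X Y := by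
  simp only [DA, k.lc.smul_left, k.m.g_add_left, k.m.g_add_right, k.m.g_sub_left, k.m.g_sub_right,
    k.m.g_neg_left, k.m.g_neg_right, k.m.g_smul_left, k.m.g_smul_right, k.m.g_zero_left, k.m.g_zero_right,
    k.m.φ_add, k.m.φ_sub, k.m.φ_neg, k.m.φ_smul, k.m.φ_zero, k.m.η_add, k.m.η_sub, k.m.η_neg, k.m.η_smul, k.m.η_zero, k.ps_smul]; module
theorem DA_skew (X Y Z : V) : g (DA φ D ξ X Y) Z = - g (DA φ D ξ X Z) Y := by
  have h1 := k.lc.metric X (ps D ξ (φ Y)) Z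
  have h2 := k.lc.metric X (ps D ξ (φ Z)) Y
  rw [k.A_skew, C.act_neg] at h1
  have a1 := k.A_skew (D X Y) Z
  have a2 := k.A_skew (D X Z) Y
  simp only [DA, k.m.g_add_left, k.m.g_add_right, k.m.g_sub_left, k.m.g_sub_right,
    k.m.g_neg_left, k.m.g_neg_right, k.m.g_smul_left, k.m.g_smul_right, k.m.g_zero_left, k.m.g_zero_right,
    k.m.φ_add, k.m.φ_sub, k.m.φ_neg, k.m.φ_smul, k.m.φ_zero, k.m.η_add, k.m.η_sub, k.m.η_neg, k.m.η_smul, k.m.η_zero]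
  linear_combination - h1 - h2 - a1 - a2
theorem DA_self (X Y : V) : g (DA φ D ξ X Y) Y = 0 := by
  apply two_cancel'
  linear_combination k.DA_skew X Y Y
theorem η_DA (X Y : V) : η (DA φ D ξ X Y) = g (ps D ξ (φ Y)) (ps D ξ X) := by
  have h := k.actη X (ps D ξ (φ Y))
  rw [k.η_ps, C.act_zero] at h
  simp only [DA, k.m.g_add_left, k.m.g_add_right, k.m.g_sub_left, k.m.g_sub_right,
    k.m.g_neg_left, k.m.g_neg_right, k.m.g_smul_left, k.m.g_smul_right, k.m.g_zero_left, k.m.g_zero_right,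
    k.m.φ_add, k.m.φ_sub, k.m.φ_neg, k.m.φ_smul, k.m.φ_zero, k.m.η_add, k.m.η_sub, k.m.η_neg, k.m.η_smul, k.m.η_zero, k.η_ps]
  linear_combination - h
theorem A_self (X : V) : g (ps D ξ (φ X)) X = 0 := by
  apply two_cancel'
  linear_combination k.A_skew X X
theorem ps_self (X : V) : g (ps D ξ X) X = 0 := by
  apply two_cancel'
  linear_combination k.ps_skew X X - k.m.g_symm X (ps D ξ X)
theorem B_self (X : V) : g (ps D ξ (φ X)) (ps D ξ X) = 0 := by
  apply two_cancel'
  linear_combination k.B_skew X X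
theorem DA_S (X Z : V) : g (DA φ D ξ X Z) X = - SS g D ξ X X (φ Z)
    + 2 * η X * g (ps D ξ (φ Z)) (ps D ξ X) := by
  have h := k.S_skew X X (φ Z)
  have h1 := k.B_self X
  have h2 := k.ps_skew (φ (D X Z)) X
  rw [h, SS, k.Dφ]
  simp only [DA, k.m.g_add_left, k.m.g_add_right, k.m.g_sub_left, k.m.g_sub_right,
    k.m.g_neg_left, k.m.g_neg_right, k.m.g_smul_left, k.m.g_smul_right, k.m.g_zero_left, k.m.g_zero_right,
    k.m.φ_add, k.m.φ_sub, k.m.φ_neg, k.m.φ_smul, k.m.φ_zero, k.m.η_add, k.m.η_sub, k.m.η_neg, k.m.η_smul, k.m.η_zero, k.m.gξ', k.η_ps]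
  linear_combination -h2 + η Z * h1

section frame
variable {d : ℕ} {e : Fin d → V} (hf : ∀ X, X = ∑ i, g X (e i) • e i)
include hf

theorem divA (Z : V) : ∑ i, g (DA φ D ξ (e i) Z) (e i) = 0 := by
  have hB : ∑ i, η (e i) * (2 * g (ps D ξ (φ Z)) (ps D ξ (e i))) = 0 := by
    rw [k.sum_η hf (fun U => 2 * g (ps D ξ (φ Z)) (ps D ξ U))]
    · simp only [k.ps_ξ, k.m.g_add_left, k.m.g_add_right, k.m.g_sub_left, k.m.g_sub_right,
    k.m.g_neg_left, k.m.g_neg_right, k.m.g_smul_left, k.m.g_smul_right, k.m.g_zero_left, k.m.g_zero_right,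
    k.m.φ_add, k.m.φ_sub, k.m.φ_neg, k.m.φ_smul, k.m.φ_zero, k.m.η_add, k.m.η_sub, k.m.η_neg, k.m.η_smul, k.m.η_zero, mul_zero]
    · intro X Y; simp only [k.ps_add, k.m.g_add_left, k.m.g_add_right, k.m.g_sub_left, k.m.g_sub_right,
    k.m.g_neg_left, k.m.g_neg_right, k.m.g_smul_left, k.m.g_smul_right, k.m.g_zero_left, k.m.g_zero_right,
    k.m.φ_add, k.m.φ_sub, k.m.φ_neg, k.m.φ_smul, k.m.φ_zero, k.m.η_add, k.m.η_sub, k.m.η_neg, k.m.η_smul, k.m.η_zero]; ring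
    · intro a X; simp only [k.ps_smul, k.m.g_add_left, k.m.g_add_right, k.m.g_sub_left, k.m.g_sub_right,
    k.m.g_neg_left, k.m.g_neg_right, k.m.g_smul_left, k.m.g_smul_right, k.m.g_zero_left, k.m.g_zero_right,
    k.m.φ_add, k.m.φ_sub, k.m.φ_neg, k.m.φ_smul, k.m.φ_zero, k.m.η_add, k.m.η_sub, k.m.η_neg, k.m.η_smul, k.m.η_zero]; ring
  have h := k.s_φ hf Z
  rw [← hB, ← sub_eq_zero, ← Finset.sum_sub_distrib] at h
  rw [← neg_eq_zero, ← h, ← Finset.sum_neg_distrib]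
  refine Finset.sum_congr rfl fun i _ => ?_
  rw [k.DA_S]; ring

theorem sumM1 (Y Z : V) : ∑ i, g (MM φ ξ η g D (e i) Y Z) (e i) =
    2 * g Y (ps D ξ (ps D ξ (φ Z))) + g Z (ps D ξ (ps D ξ (φ Y))) - g (DA φ D ξ ξ Z) Y := by
  have h1 : ∀ Y Z, ∑ i, g (ps D ξ (φ Z)) (e i) * g Y (ps D ξ (e i)) = g Y (ps D ξ (ps D ξ (φ Z))) :=
    fun Y Z => k.sum_lin hf (fun U => g Y (ps D ξ U)) (fun X X' => by simp only [k.ps_add, k.m.g_add_left, k.m.g_add_right, k.m.g_sub_left, k.m.g_sub_right,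
    k.m.g_neg_left, k.m.g_neg_right, k.m.g_smul_left, k.m.g_smul_right, k.m.g_zero_left, k.m.g_zero_right,
    k.m.φ_add, k.m.φ_sub, k.m.φ_neg, k.m.φ_smul, k.m.φ_zero, k.m.η_add, k.m.η_sub, k.m.η_neg, k.m.η_smul, k.m.η_zero])
      (fun a X => by simp only [k.ps_smul, k.m.g_add_left, k.m.g_add_right, k.m.g_sub_left, k.m.g_sub_right,
    k.m.g_neg_left, k.m.g_neg_right, k.m.g_smul_left, k.m.g_smul_right, k.m.g_zero_left, k.m.g_zero_right,
    k.m.φ_add, k.m.φ_sub, k.m.φ_neg, k.m.φ_smul, k.m.φ_zero, k.m.η_add, k.m.η_sub, k.m.η_neg, k.m.η_smul, k.m.η_zero]) _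
  have h2 := k.sum_η hf (fun U => g (DA φ D ξ U Z) Y)
    (fun X X' => by simp only [k.DA_add1, k.m.g_add_left, k.m.g_add_right, k.m.g_sub_left, k.m.g_sub_right,
    k.m.g_neg_left, k.m.g_neg_right, k.m.g_smul_left, k.m.g_smul_right, k.m.g_zero_left, k.m.g_zero_right,
    k.m.φ_add, k.m.φ_sub, k.m.φ_neg, k.m.φ_smul, k.m.φ_zero, k.m.η_add, k.m.η_sub, k.m.η_neg, k.m.η_smul, k.m.η_zero]) (fun a X => by simp only [k.DA_smul1, k.m.g_add_left, k.m.g_add_right, k.m.g_sub_left, k.m.g_sub_right,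
    k.m.g_neg_left, k.m.g_neg_right, k.m.g_smul_left, k.m.g_smul_right, k.m.g_zero_left, k.m.g_zero_right,
    k.m.φ_add, k.m.φ_sub, k.m.φ_neg, k.m.φ_smul, k.m.φ_zero, k.m.η_add, k.m.η_sub, k.m.η_neg, k.m.η_smul, k.m.η_zero])
  have d1 := k.divA hf Z
  have d2 := k.divA hf Y
  have : ∑ i, g (MM φ ξ η g D (e i) Y Z) (e i) =
    2 * ∑ i, g (ps D ξ (φ Z)) (e i) * g Y (ps D ξ (e i))
    + ∑ i, g (ps D ξ (φ Y)) (e i) * g Z (ps D ξ (e i))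
    - 2 * η Y * ∑ i, g (DA φ D ξ (e i) Z) (e i) - η Z * ∑ i, g (DA φ D ξ (e i) Y) (e i)
    - ∑ i, η (e i) * g (DA φ D ξ (e i) Z) Y := by
    simp only [Finset.mul_sum, ← Finset.sum_add_distrib, ← Finset.sum_sub_distrib]
    refine Finset.sum_congr rfl fun i _ => ?_
    simp only [MM, k.m.g_add_left, k.m.g_add_right, k.m.g_sub_left, k.m.g_sub_right,
    k.m.g_neg_left, k.m.g_neg_right, k.m.g_smul_left, k.m.g_smul_right, k.m.g_zero_left, k.m.g_zero_right,
    k.m.φ_add, k.m.φ_sub, k.m.φ_neg, k.m.φ_smul, k.m.φ_zero, k.m.η_add, k.m.η_sub, k.m.η_neg, k.m.η_smul, k.m.η_zero, k.ps_self, k.m.gξ']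
    ring
  rw [this, h1, h1, h2, d1, d2]; ring

theorem sumM2 (Y Z : V) : ∑ i, g (MM φ ξ η g D Y (e i) Z) (e i) = 0 := by
  have h1 := k.sum_lin hf (fun U => g (ps D ξ Y) U) (fun X X' => by simp only [k.m.g_add_left, k.m.g_add_right, k.m.g_sub_left, k.m.g_sub_right,
    k.m.g_neg_left, k.m.g_neg_right, k.m.g_smul_left, k.m.g_smul_right, k.m.g_zero_left, k.m.g_zero_right,
    k.m.φ_add, k.m.φ_sub, k.m.φ_neg, k.m.φ_smul, k.m.φ_zero, k.m.η_add, k.m.η_sub, k.m.η_neg, k.m.η_smul, k.m.η_zero])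
      (fun a X => by simp only [k.m.g_add_left, k.m.g_add_right, k.m.g_sub_left, k.m.g_sub_right,
    k.m.g_neg_left, k.m.g_neg_right, k.m.g_smul_left, k.m.g_smul_right, k.m.g_zero_left, k.m.g_zero_right,
    k.m.φ_add, k.m.φ_sub, k.m.φ_neg, k.m.φ_smul, k.m.φ_zero, k.m.η_add, k.m.η_sub, k.m.η_neg, k.m.η_smul, k.m.η_zero]) (ps D ξ (φ Z))
  have h2 := k.sum_η hf (fun U => g (DA φ D ξ Y Z) U)
    (fun X X' => by simp only [k.m.g_add_left, k.m.g_add_right, k.m.g_sub_left, k.m.g_sub_right,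
    k.m.g_neg_left, k.m.g_neg_right, k.m.g_smul_left, k.m.g_smul_right, k.m.g_zero_left, k.m.g_zero_right,
    k.m.φ_add, k.m.φ_sub, k.m.φ_neg, k.m.φ_smul, k.m.φ_zero, k.m.η_add, k.m.η_sub, k.m.η_neg, k.m.η_smul, k.m.η_zero]) (fun a X => by simp only [k.m.g_add_left, k.m.g_add_right, k.m.g_sub_left, k.m.g_sub_right,
    k.m.g_neg_left, k.m.g_neg_right, k.m.g_smul_left, k.m.g_smul_right, k.m.g_zero_left, k.m.g_zero_right,
    k.m.φ_add, k.m.φ_sub, k.m.φ_neg, k.m.φ_smul, k.m.φ_zero, k.m.η_add, k.m.η_sub, k.m.η_neg, k.m.η_smul, k.m.η_zero])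
  have : ∑ i, g (MM φ ξ η g D Y (e i) Z) (e i) =
    3 * ∑ i, g (ps D ξ (φ Z)) (e i) * g (ps D ξ Y) (e i)
    - 3 * ∑ i, η (e i) * g (DA φ D ξ Y Z) (e i) := by
    simp only [Finset.mul_sum, ← Finset.sum_add_distrib, ← Finset.sum_sub_distrib]
    refine Finset.sum_congr rfl fun i _ => ?_
    simp only [MM, k.m.g_add_left, k.m.g_add_right, k.m.g_sub_left, k.m.g_sub_right,
    k.m.g_neg_left, k.m.g_neg_right, k.m.g_smul_left, k.m.g_smul_right, k.m.g_zero_left, k.m.g_zero_right,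
    k.m.φ_add, k.m.φ_sub, k.m.φ_neg, k.m.φ_smul, k.m.φ_zero, k.m.η_add, k.m.η_sub, k.m.η_neg, k.m.η_smul, k.m.η_zero, k.A_self, k.DA_self, k.m.gξ', k.m.g_symm (e i)]
    ring
  rw [this, h1, h2, k.m.gξ, k.η_DA, k.m.g_symm]; ring

theorem rho_skew (Y Z : V) : ∑ i, g (C.curv D (e i) Y Z) (φ (e i)) =
    - ∑ i, g (C.curv D (e i) Z Y) (φ (e i)) := by
  have h := k.trans hf (fun X W => g (C.curv D X Z Y) W) (fun X X' W => by simp only [k.R_add, k.m.g_add_left, k.m.g_add_right, k.m.g_sub_left, k.m.g_sub_right,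
    k.m.g_neg_left, k.m.g_neg_right, k.m.g_smul_left, k.m.g_smul_right, k.m.g_zero_left, k.m.g_zero_right,
    k.m.φ_add, k.m.φ_sub, k.m.φ_neg, k.m.φ_smul, k.m.φ_zero, k.m.η_add, k.m.η_sub, k.m.η_neg, k.m.η_smul, k.m.η_zero])
      (fun a X W => by simp only [k.R_smul, k.m.g_add_left, k.m.g_add_right, k.m.g_sub_left, k.m.g_sub_right,
    k.m.g_neg_left, k.m.g_neg_right, k.m.g_smul_left, k.m.g_smul_right, k.m.g_zero_left, k.m.g_zero_right,
    k.m.φ_add, k.m.φ_sub, k.m.φ_neg, k.m.φ_smul, k.m.φ_zero, k.m.η_add, k.m.η_sub, k.m.η_neg, k.m.η_smul, k.m.η_zero]) (fun X W W' => by simp only [k.m.g_add_left, k.m.g_add_right, k.m.g_sub_left, k.m.g_sub_right,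
    k.m.g_neg_left, k.m.g_neg_right, k.m.g_smul_left, k.m.g_smul_right, k.m.g_zero_left, k.m.g_zero_right,
    k.m.φ_add, k.m.φ_sub, k.m.φ_neg, k.m.φ_smul, k.m.φ_zero, k.m.η_add, k.m.η_sub, k.m.η_neg, k.m.η_smul, k.m.η_zero])
      (fun a X W => by simp only [k.m.g_add_left, k.m.g_add_right, k.m.g_sub_left, k.m.g_sub_right,
    k.m.g_neg_left, k.m.g_neg_right, k.m.g_smul_left, k.m.g_smul_right, k.m.g_zero_left, k.m.g_zero_right,
    k.m.φ_add, k.m.φ_sub, k.m.φ_neg, k.m.φ_smul, k.m.φ_zero, k.m.η_add, k.m.η_sub, k.m.η_neg, k.m.η_smul, k.m.η_zero]) φ (fun X => - φ X)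
      (fun X Y => by rw [k.skew, k.m.g_neg_right])
  simp only [k.m.g_neg_right, Finset.sum_neg_distrib] at h
  rw [← h]
  refine Finset.sum_congr rfl fun i _ => ?_
  rw [k.R4, k.R1g, k.R2, neg_neg]

theorem ricφ (Y Z : V) : ricci C D g e Y (φ Z) = - ∑ i, g (C.curv D (e i) Y Z) (φ (e i))
    + (2 * g Y (ps D ξ (ps D ξ (φ Z))) + g Z (ps D ξ (ps D ξ (φ Y))) - g (DA φ D ξ ξ Z) Y) := by
  rw [← k.sumM1 hf, ← sub_zero (∑ i, g (MM φ ξ η g D (e i) Y Z) (e i)), ← k.sumM2 hf Y Z,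
    ← Finset.sum_sub_distrib, ← Finset.sum_neg_distrib, ← Finset.sum_add_distrib]
  refine Finset.sum_congr rfl fun i _ => ?_
  rw [k.Rφ]
  simp only [k.m.g_add_left, k.m.g_add_right, k.m.g_sub_left, k.m.g_sub_right,
    k.m.g_neg_left, k.m.g_neg_right, k.m.g_smul_left, k.m.g_smul_right, k.m.g_zero_left, k.m.g_zero_right,
    k.m.φ_add, k.m.φ_sub, k.m.φ_neg, k.m.φ_smul, k.m.φ_zero, k.m.η_add, k.m.η_sub, k.m.η_neg, k.m.η_smul, k.m.η_zero, k.skew]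
  ring

theorem ricφ_skew (Y Z : V) : ricci C D g e Y (φ Z) + ricci C D g e Z (φ Y) = 0 := by
  rw [k.ricφ hf, k.ricφ hf, k.rho_skew hf Z Y]
  have a1 := k.ps_skew Y (ps D ξ (φ Z))
  have a2 := k.ps_skew Z (ps D ξ (φ Y))
  rw [k.m.g_symm] at a1 a2
  have a3 := k.B_skew Y Z
  have a4 := k.DA_skew ξ Y Z
  linear_combination 3 * a1 + 3 * a2 - 3 * a3 - a4

omit hf in
theorem ric_add (X X' Y : V) : ricci C D g e (X + X') Y = ricci C D g e X Y + ricci C D g e X' Y := by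
  simp only [ricci, ← Finset.sum_add_distrib]
  refine Finset.sum_congr rfl fun i _ => ?_
  rw [k.R1g, k.R_add, k.m.g_add_left, k.R1g (e i) X, k.R1g (e i) X']; ring
omit hf in
theorem ric_smul (f : F) (X Y : V) : ricci C D g e (f • X) Y = f * ricci C D g e X Y := by
  simp only [ricci, Finset.mul_sum]
  refine Finset.sum_congr rfl fun i _ => ?_
  rw [k.R1g, k.R_smul, k.m.g_smul_left, k.R1g (e i) X]; ring
end frame
end Core
/-- Proposition `Prop:Ric` (i)-(ii) and its Corollary.
On an anti-quasi-Sasakian manifold with `ψ = -∇ξ`: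
`Ric(ξ,ξ) = |∇ξ|² = |ψ|²` and `Ric(ξ,X) = 0` for horizontal `X`; consequently the
Ricci operator `Q` (with `g(QX,Y) = Ric(X,Y)`) satisfies `Qξ = |ψ|² ξ` and `Qφ = φQ`.
The Ricci tensor is computed through a given global orthonormal frame `e`, and `g` is
nondegenerate (as a Riemannian metric). -/
theorem statement15
    {F V : Type} [CommRing F] [Algebra ℝ F] [AddCommGroup V] [Module F V]
    (C : VFCalc F V) (φ : V → V) (ξ : V) (η : V → F) (g : V → V → F)
    (hACMS : IsACMS φ ξ η g)
    (hgnd : ∀ X, (∀ Y, g X Y = 0) → X = 0)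
    (D : V → V → V) (hLC : IsLeviCivita C g D)
    (hAqS : IsAqS C φ ξ η g)
    (ψ : V → V) (hψ : ∀ X, ψ X = -D X ξ)
    -- a global orthonormal frame
    (d : ℕ) (e : Fin d → V)
    (he_on : ∀ i j, g (e i) (e j) = if i = j then 1 else 0)
    (he_frame : ∀ X, X = ∑ i, g X (e i) • e i) :
    -- Ric(ξ,ξ) = |∇ξ|² = |ψ|²
    ricci C D g e ξ ξ = (∑ i, g (D (e i) ξ) (D (e i) ξ)) ∧
    ricci C D g e ξ ξ = (∑ i, g (ψ (e i)) (ψ (e i))) ∧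
    -- Ric(ξ,X) = 0 for horizontal X
    (∀ X, η X = 0 → ricci C D g e ξ X = 0) ∧
    -- the Ricci operator: Qξ = |ψ|² ξ and Qφ = φQ
    (∀ Q : V → V, (∀ X Y, g (Q X) Y = ricci C D g e X Y) →
      Q ξ = (∑ i, g (ψ (e i)) (ψ (e i))) • ξ ∧ ∀ X, Q (φ X) = φ (Q X)) := by
  have hm := red_ACMS hACMS
  have k : Core C (fun X => φ X - (η (φ ξ) * η X) • ξ) ξ η g D :=
    { m := hm, nd := hgnd, lc := hLC, aq := red_AqS hACMS hAqS,
      φξ := by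
        show φ ξ - (η (φ ξ) * η ξ) • ξ = 0
        rw [hACMS.η_ξ, mul_one, ← hACMS.φξ', sub_self] }
  have hps : ∀ X, ψ X = ps D ξ X := hψ
  have hr := k.ric_ξξ (e := e)
  have h3 : ∀ X, ricci C D g e ξ X = η X * ∑ i, g (ps D ξ (e i)) (ps D ξ (e i)) := fun X => by
    rw [k.ric_symm, k.ric_ξ he_frame]
  simp only [hps]
  refine ⟨?_, hr, ?_, ?_⟩
  · rw [hr]
    refine Finset.sum_congr rfl fun i _ => ?_
    rw [ps, k.m.g_neg_left, k.m.g_neg_right, neg_neg]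
  · intro X hX
    rw [h3, hX, zero_mul]
  · intro Q hQ
    have hQξ : Q ξ = (∑ i, g (ps D ξ (e i)) (ps D ξ (e i))) • ξ := by
      apply k.ext
      intro Y
      rw [hQ, h3, k.m.g_smul_left, k.m.gξ', mul_comm]
    refine ⟨hQξ, fun X => ?_⟩
    have hηQ : η (Q X) = η X * ∑ i, g (ps D ξ (e i)) (ps D ξ (e i)) := by
      rw [← k.m.gξ, hQ, k.ric_ξ he_frame]
    have h0 : Q (φ X - (η (φ ξ) * η X) • ξ) = φ (Q X) - (η (φ ξ) * η (Q X)) • ξ := by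
      apply k.ext
      intro Y
      have a1 := k.ricφ_skew he_frame Y X
      have a2 := k.skew (Q X) Y
      rw [hQ X] at a2
      rw [hQ, k.ric_symm]
      linear_combination a1 - a2
    have h1 : Q (φ X) = Q (φ X - (η (φ ξ) * η X) • ξ) + (η (φ ξ) * η X) • Q ξ := by
      apply k.ext
      intro Y
      rw [k.m.g_add_left, k.m.g_smul_left, hQ, hQ, hQ, ← k.ric_smul, ← k.ric_add, sub_add_cancel]
    rw [h1, h0, hηQ, hQξ]
    module
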